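/- arXiv:1503.08373 — 2 statements merged into one kernel-verified Lean document; each statement's English description precedes it below -/
import Mathlib

section
/- Let E be a complex Banach space and k ≥ 0 an integer. Let f : ℝ → E be of class C^k, such that each derivative f^(j) (0 ≤ j ≤ k) is Bochner integrable on ℝ, and suppose there is a constant K ≥ 0 such that the second differences satisfy ∫_ℝ ‖f^(k)(τ+2h) − 2·f^(k)(τ+h) + f^(k)(τ)‖ dτ ≤ K·|h| for every real h ≠ 0. Then there exists a constant C = C(k) > 0, independent of f, such that for every t ∈ ℝ: ‖∫_ℝ f(τ)·e^{iτt} dτ‖ ≤ C·(1+|t|)^{−(k+1)} · ( Σ_{j=0}^{k} ∫_ℝ ‖f^(j)(τ)‖ dτ + K ). -/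
open MeasureTheory

section FourierDecay

variable {E : Type*} [NormedAddCommGroup E] [NormedSpace ℂ E]

lemma norm_exp_I_mul_mul_smul (τ t : ℝ) (x : E) :
    ‖Complex.exp (Complex.I * τ * t) • x‖ = ‖x‖ := by
  rw [norm_smul, mul_assoc, mul_comm Complex.I, ← Complex.ofReal_mul,
    Complex.norm_exp_ofReal_mul_I, one_mul]

lemma norm_integral_exp_I_smul_le (g : ℝ → E) (t : ℝ) :
    ‖∫ τ : ℝ, Complex.exp (Complex.I * τ * t) • g τ‖ ≤ ∫ τ : ℝ, ‖g τ‖ := by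
  refine (norm_integral_le_integral_norm _).trans_eq ?_
  simp_rw [norm_exp_I_mul_mul_smul]

lemma MeasureTheory.Integrable.exp_I_smul {g : ℝ → E} (hg : Integrable g) (t : ℝ) :
    Integrable fun τ : ℝ => Complex.exp (Complex.I * τ * t) • g τ := by
  refine hg.mono (Continuous.aestronglyMeasurable (by fun_prop) |>.smul
    hg.aestronglyMeasurable) (.of_forall fun τ => ?_)
  rw [norm_exp_I_mul_mul_smul]

lemma integral_exp_I_smul_comp_add (g : ℝ → E) (t h : ℝ) :
    ∫ τ : ℝ, Complex.exp (Complex.I * τ * t) • g (τ + h) =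
      Complex.exp (-(Complex.I * h * t)) • ∫ τ : ℝ, Complex.exp (Complex.I * τ * t) • g τ := by
  rw [← integral_add_right_eq_self (fun τ : ℝ => Complex.exp (Complex.I * τ * t) • g τ) h,
    ← integral_smul]
  refine integral_congr_ae (.of_forall fun τ => ?_)
  simp only [smul_smul, ← Complex.exp_add]
  push_cast
  ring_nf

lemma integral_exp_I_smul_second_difference {g : ℝ → E} (hg : Integrable g) {t : ℝ}
    (ht : t ≠ 0) :
    ∫ τ : ℝ, Complex.exp (Complex.I * τ * t) •
        (g (τ + 2 * (Real.pi / t)) - 2 • g (τ + Real.pi / t) + g τ) =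
      (4 : ℂ) • ∫ τ : ℝ, Complex.exp (Complex.I * τ * t) • g τ := by
  have ht' : (t : ℂ) ≠ 0 := Complex.ofReal_ne_zero.mpr ht
  have h₂ := (hg.comp_add_right (2 * (Real.pi / t))).exp_I_smul t
  have h₁ := ((hg.comp_add_right (Real.pi / t)).exp_I_smul t).smul (2 : ℂ)
  have e₁ : Complex.exp (-(Complex.I * ↑(Real.pi / t) * t)) = -1 := by
    rw [show -(Complex.I * ↑(Real.pi / t) * t) = -(Real.pi * Complex.I) by
      push_cast; field_simp, Complex.exp_neg, Complex.exp_pi_mul_I]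
    norm_num
  have e₂ : Complex.exp (-(Complex.I * ↑(2 * (Real.pi / t)) * t)) = 1 := by
    rw [show -(Complex.I * ↑(2 * (Real.pi / t)) * t) = -(2 * Real.pi * Complex.I) by
      push_cast; field_simp, Complex.exp_neg, Complex.exp_two_pi_mul_I, inv_one]
  calc
    _ = ∫ τ : ℝ, (Complex.exp (Complex.I * τ * t) • g (τ + 2 * (Real.pi / t)) -
          (2 : ℂ) • Complex.exp (Complex.I * τ * t) • g (τ + Real.pi / t) +
          Complex.exp (Complex.I * τ * t) • g τ) := by
      congr 1 with τ
      module
    _ = _ := by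
      have h₁₂ := h₂.sub h₁
      simp only [Pi.sub_def, Pi.smul_def] at h₁₂ h₁
      rw [integral_add h₁₂ (hg.exp_I_smul t), integral_sub h₂ h₁, integral_smul,
        integral_exp_I_smul_comp_add, integral_exp_I_smul_comp_add, e₁, e₂]
      module

lemma abs_mul_norm_integral_exp_I_smul_le {g : ℝ → E} (hg : Integrable g) {K : ℝ} (hK : 0 ≤ K)
    (hdiff : ∀ h : ℝ, h ≠ 0 →
      (∫ τ : ℝ, ‖g (τ + 2 * h) - 2 • g (τ + h) + g τ‖) ≤ K * |h|) (t : ℝ) :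
    |t| * ‖∫ τ : ℝ, Complex.exp (Complex.I * τ * t) • g τ‖ ≤ K := by
  rcases eq_or_ne t 0 with rfl | ht
  · simpa using hK
  have ht' : 0 < |t| := abs_pos.mpr ht
  have h := (norm_integral_exp_I_smul_le _ t).trans
    (hdiff (Real.pi / t) (div_ne_zero Real.pi_ne_zero ht))
  rw [integral_exp_I_smul_second_difference hg ht, norm_smul, abs_div,
    abs_of_pos Real.pi_pos, ← mul_div_assoc, le_div_iff₀ ht'] at h
  norm_num at h
  nlinarith [Real.pi_lt_four]

lemma integral_exp_I_smul_eq_fourier (g : ℝ → E) (t : ℝ) :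
    ∫ τ : ℝ, Complex.exp (Complex.I * τ * t) • g τ =
      FourierTransform.fourier g (-t / (2 * Real.pi)) := by
  rw [Real.fourier_real_eq_integral_exp_smul]
  refine integral_congr_ae (.of_forall fun τ => ?_)
  have : (Real.pi : ℂ) ≠ 0 := Complex.ofReal_ne_zero.mpr Real.pi_ne_zero
  simp only
  congr 2
  push_cast
  field_simp

lemma norm_integral_exp_I_smul_iteratedDeriv [CompleteSpace E] {f : ℝ → E} {k : ℕ}
    (hf : ContDiff ℝ (k : ℕ∞) f) (hint : ∀ j ≤ k, Integrable (iteratedDeriv j f)) (t : ℝ) :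
    ‖∫ τ : ℝ, Complex.exp (Complex.I * τ * t) • iteratedDeriv k f τ‖ =
      |t| ^ k * ‖∫ τ : ℝ, Complex.exp (Complex.I * τ * t) • f τ‖ := by
  rw [integral_exp_I_smul_eq_fourier, integral_exp_I_smul_eq_fourier,
    Real.fourier_iteratedDeriv hf (fun n hn => hint n (by exact_mod_cast hn)) le_rfl,
    norm_smul, norm_pow]
  congr 2
  have := Real.pi_pos
  simp [abs_of_pos this]
  field_simp

end FourierDecay

open MeasureTheory

/-- Shibata-type Fourier decay lemma (case `σ = 1`): if `f : ℝ → E` is `C^k` with all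
derivatives up to order `k` integrable and the `k`-th derivative has an `L¹` second-difference
modulus bounded by `K|h|`, then `∫ f(τ) e^{iτt} dτ` decays like `(1+|t|)^{-(k+1)}`, with a
constant depending only on `k`. -/
theorem stmt_1 (E : Type*) [NormedAddCommGroup E] [NormedSpace ℂ E] [CompleteSpace E]
    (k : ℕ) :
    ∃ C : ℝ, 0 < C ∧
      ∀ (f : ℝ → E) (K : ℝ), 0 ≤ K →
        ContDiff ℝ (k : ℕ∞) f →
        (∀ j ≤ k, Integrable (iteratedDeriv j f)) →
        (∀ h : ℝ, h ≠ 0 →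
          (∫ τ : ℝ, ‖iteratedDeriv k f (τ + 2 * h) - 2 • iteratedDeriv k f (τ + h) +
              iteratedDeriv k f τ‖) ≤ K * |h|) →
        ∀ t : ℝ,
          ‖∫ τ : ℝ, Complex.exp (Complex.I * τ * t) • f τ‖ ≤
            C * (1 + |t|) ^ (-((k : ℝ) + 1)) *
              ((∑ j ∈ Finset.range (k + 1), ∫ τ : ℝ, ‖iteratedDeriv j f τ‖) + K) := by
  refine ⟨2 ^ k, by positivity, fun f K hK hf hint hdiff t => ?_⟩
  have hlow := norm_integral_exp_I_smul_le f t
  have hhigh := abs_mul_norm_integral_exp_I_smul_le (hint k le_rfl) hK hdiff t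
  rw [norm_integral_exp_I_smul_iteratedDeriv hf hint, ← mul_assoc, ← pow_succ'] at hhigh
  have hsum : ∫ τ : ℝ, ‖f τ‖ ≤
      ∑ j ∈ Finset.range (k + 1), ∫ τ : ℝ, ‖iteratedDeriv j f τ‖ := by
    simpa using Finset.single_le_sum (f := fun j => ∫ τ : ℝ, ‖iteratedDeriv j f τ‖)
      (fun j _ => integral_nonneg fun τ => norm_nonneg _) (Finset.mem_range.mpr k.succ_pos)
  have hpow : (1 + |t|) ^ (k + 1) ≤ 2 ^ k * (1 + |t| ^ (k + 1)) := by
    simpa using add_pow_le zero_le_one (abs_nonneg t) (k + 1)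
  have hpos : 0 < 1 + |t| := by positivity
  rw [Real.rpow_neg hpos.le, ← Nat.cast_succ, Real.rpow_natCast, mul_right_comm,
    ← div_eq_mul_inv, le_div_iff₀ (by positivity), mul_comm]
  refine (mul_le_mul_of_nonneg_right hpow (norm_nonneg _)).trans ?_
  rw [mul_assoc]
  gcongr
  linarith
end

section
/- Let E be a complex Banach space, σ ∈ (0,1], and let f : ℝ → E be Bochner integrable with a constant K ≥ 0 such that ∫_ℝ ‖f(τ+h) − f(τ)‖ dτ ≤ K·|h|^σ for every real h ≠ 0. Then for every real t ≠ 0: ‖∫_ℝ e^{itτ} f(τ) dτ‖ ≤ (K/2)·(π/|t|)^σ. -/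
open MeasureTheory

/-- The character `τ ↦ e^{itτ}` has modulus one. -/
lemma norm_exp_I_mul_mul (t τ : ℝ) : ‖Complex.exp (Complex.I * t * τ)‖ = 1 := by
  rw [show Complex.I * t * τ = ((t * τ : ℝ) : ℂ) * Complex.I by push_cast; ring]
  exact Complex.norm_exp_ofReal_mul_I _

/-- Multiplying by the character `τ ↦ e^{itτ}` preserves integrability. -/
lemma integrable_exp_I_smul {E : Type*} [NormedAddCommGroup E] [NormedSpace ℂ E]
    {f : ℝ → E} (hf : Integrable f) (t : ℝ) :
    Integrable fun τ : ℝ => Complex.exp (Complex.I * t * τ) • f τ := by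
  have hc : Continuous fun τ : ℝ => Complex.exp (Complex.I * t * τ) := by fun_prop
  refine hf.mono (hc.aestronglyMeasurable.smul hf.1) (.of_forall fun τ => ?_)
  rw [norm_smul, norm_exp_I_mul_mul, one_mul]

/-- Translating `f` by half a period of `τ ↦ e^{itτ}` changes the sign of the Fourier integral. -/
lemma integral_exp_I_smul_translate {E : Type*} [NormedAddCommGroup E] [NormedSpace ℂ E]
    (f : ℝ → E) {t : ℝ} (ht : t ≠ 0) :
    ∫ τ : ℝ, Complex.exp (Complex.I * t * τ) • f (τ + Real.pi / t) =
      -∫ τ : ℝ, Complex.exp (Complex.I * t * τ) • f τ := by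
  rw [← integral_add_right_eq_self (fun τ : ℝ => Complex.exp (Complex.I * t * τ) • f τ)
    (Real.pi / t), ← integral_neg]
  congr 1 with τ
  have htC : (t : ℂ) ≠ 0 := by exact_mod_cast ht
  have hphase : Complex.I * t * ((τ + Real.pi / t : ℝ) : ℂ) =
      Complex.I * t * τ + Real.pi * Complex.I := by
    push_cast
    field_simp
  rw [hphase, Complex.exp_add, Complex.exp_pi_mul_I, mul_neg_one, neg_smul, neg_neg]

/-- Phase-shift argument underlying Lemma 4.1 of the paper: if `f` is integrable with `L¹`
Hölder modulus of continuity `∫ ‖f(τ+h) - f(τ)‖ dτ ≤ K|h|^σ`, then for `t ≠ 0` one has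
`‖∫ e^{itτ} f(τ) dτ‖ ≤ (K/2)(π/|t|)^σ`. -/
theorem stmt_8 (E : Type*) [NormedAddCommGroup E] [NormedSpace ℂ E] [CompleteSpace E]
    (σ : ℝ) (hσ0 : 0 < σ) (hσ1 : σ ≤ 1) (f : ℝ → E) (K : ℝ) (hK : 0 ≤ K)
    (hf : Integrable f)
    (hmod : ∀ h : ℝ, h ≠ 0 → (∫ τ : ℝ, ‖f (τ + h) - f τ‖) ≤ K * |h| ^ σ) :
    ∀ t : ℝ, t ≠ 0 →
      ‖∫ τ : ℝ, Complex.exp (Complex.I * t * τ) • f τ‖ ≤ (K / 2) * (Real.pi / |t|) ^ σ := by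
  intro t ht
  have hint := integrable_exp_I_smul hf t
  have hint' := integrable_exp_I_smul (hf.comp_add_right (Real.pi / t)) t
  have hdiff : ∫ τ : ℝ, Complex.exp (Complex.I * t * τ) • (f (τ + Real.pi / t) - f τ) =
      (-2 : ℂ) • ∫ τ : ℝ, Complex.exp (Complex.I * t * τ) • f τ := by
    simp_rw [smul_sub]
    rw [integral_sub hint' hint, integral_exp_I_smul_translate f ht]
    module
  have hle := norm_integral_le_integral_norm (μ := volume)
    fun τ : ℝ => Complex.exp (Complex.I * t * τ) • (f (τ + Real.pi / t) - f τ)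
  simp only [hdiff, norm_smul, norm_exp_I_mul_mul, one_mul, norm_neg, Complex.norm_ofNat] at hle
  have hbound := hmod (Real.pi / t) (div_ne_zero Real.pi_ne_zero ht)
  rw [abs_div, abs_of_pos Real.pi_pos] at hbound
  linarith
end
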